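/- For every ε ∈ (0,1), consider the price competition game with two buyer types ℓ and r of volume 1 each and two non-abstain vendors L and R of production cost 0, where v_{ℓL} = v_{rR} = 4 − ε and v_{ℓR} = v_{rL} = 3. Then the optimal social welfare is SW* = 8 − 2ε, and for every price vector p and every assignment x consistent to p, the total subsidy cost ∑_{j∈M} s_j(x,p) is at least 2 − 2ε. Consequently, for every δ > 0 there exists a price competition game in which no pair of a price vector and a consistent assignment can be enforced as an equilibrium using subsidies of cost smaller than (1/4 − δ)·SW*. -/

import Mathlib

open Finset

/-- A price competition game with buyer types `N` and vendors `M`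
(including the special "abstain" vendor). -/
structure PCGame (N M : Type) [Fintype N] [Fintype M] where
  abstain : M
  μ : N → ℝ
  v : N → M → ℝ
  c : M → ℝ
  μ_pos : ∀ i, 0 < μ i
  v_nonneg : ∀ i j, 0 ≤ v i j
  c_nonneg : ∀ j, 0 ≤ c j
  v_abstain : ∀ i, v i abstain = 0
  c_abstain : c abstain = 0

namespace PCGame

variable {N M : Type} [Fintype N] [Fintype M]

/-- `p` is a valid price vector: every price is at least the production cost and
the abstain vendor has price `0`. -/
def IsPrice (G : PCGame N M) (p : M → ℝ) : Prop :=
  (∀ j, G.c j ≤ p j) ∧ p G.abstain = 0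

/-- `x` is a valid buyers-to-vendors assignment. -/
def IsAssignment (G : PCGame N M) (x : N → M → ℝ) : Prop :=
  (∀ i j, 0 ≤ x i j) ∧ ∀ i, ∑ j, x i j = G.μ i

/-- `x` is consistent to `p`: positive volume goes only to utility-maximizing vendors. -/
def Consistent (G : PCGame N M) (x : N → M → ℝ) (p : M → ℝ) : Prop :=
  ∀ i j, 0 < x i j → ∀ j', G.v i j' - p j' ≤ G.v i j - p j

/-- Utility of vendor `j` under assignment `x` and prices `p`. -/
noncomputable def util (G : PCGame N M) (x : N → M → ℝ) (p : M → ℝ) (j : M) : ℝ :=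
  (p j - G.c j) * ∑ i, x i j

/-- Total utility of the buyers of type `i`. -/
noncomputable def buyerUtil (G : PCGame N M) (x : N → M → ℝ) (p : M → ℝ) (i : N) : ℝ :=
  ∑ j, x i j * (G.v i j - p j)

/-- `(x, p)` is a (pure Nash) equilibrium: `x` is consistent to `p` and no (non-abstain)
vendor can increase its utility by deviating to another price. -/
def IsEquilibrium [DecidableEq M] (G : PCGame N M) (x : N → M → ℝ) (p : M → ℝ) : Prop :=
  G.IsPrice p ∧ G.IsAssignment x ∧ G.Consistent x p ∧
    ∀ j, j ≠ G.abstain → ∀ p' : ℝ, G.c j ≤ p' →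
      ∀ y, G.IsAssignment y → G.Consistent y (Function.update p j p') →
        G.util y (Function.update p j p') j ≤ G.util x p j

/-- Social welfare of assignment `x`. -/
noncomputable def SW (G : PCGame N M) (x : N → M → ℝ) : ℝ :=
  ∑ i, ∑ j, x i j * (G.v i j - G.c j)

/-- Optimal social welfare. -/
noncomputable def SWopt (G : PCGame N M) : ℝ :=
  ∑ i, G.μ i * Finset.univ.sup' ⟨G.abstain, Finset.mem_univ _⟩ (fun j => G.v i j - G.c j)

/-- `θ_j(p)`: the supremum utility of vendor `j` over all of its price deviations
(the abstain vendor cannot deviate from price `0`). -/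
noncomputable def theta [DecidableEq M] (G : PCGame N M) (p : M → ℝ) (j : M) : ℝ :=
  sSup {u : ℝ | ∃ (p' : ℝ) (y : N → M → ℝ), G.c j ≤ p' ∧ (j = G.abstain → p' = 0) ∧
    G.IsAssignment y ∧ G.Consistent y (Function.update p j p') ∧
    u = G.util y (Function.update p j p') j}

/-- The minimum subsidy that makes vendor `j` not want to deviate from `(x, p)`. -/
noncomputable def subsidy [DecidableEq M] (G : PCGame N M) (x : N → M → ℝ) (p : M → ℝ)
    (j : M) : ℝ :=
  G.theta p j - G.util x p j

end PCGame

namespace PCGame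

variable {N M : Type} [Fintype N] [Fintype M]

lemma IsAssignment.le_volume {G : PCGame N M} {x : N → M → ℝ} (hx : G.IsAssignment x)
    (i : N) (j : M) : x i j ≤ G.μ i :=
  hx.2 i ▸ Finset.single_le_sum (fun k _ => hx.1 i k) (Finset.mem_univ j)

/-- Buyers never pay more than their valuation, since they may abstain. -/
lemma Consistent.price_le_value {G : PCGame N M} {x : N → M → ℝ} {p : M → ℝ}
    (h : G.Consistent x p) (h0 : p G.abstain = 0) {i : N} {j : M} (hij : 0 < x i j) :
    p j ≤ G.v i j := by
  have := h i j hij G.abstain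
  rw [G.v_abstain, h0] at this
  linarith

lemma util_le {G : PCGame N M} {x : N → M → ℝ} {p : M → ℝ} (h0 : p G.abstain = 0)
    (hx : G.IsAssignment x) (h : G.Consistent x p) (j : M) :
    G.util x p j ≤ ∑ i, G.μ i * G.v i j := by
  rw [util, Finset.mul_sum]
  refine Finset.sum_le_sum fun i _ => ?_
  rcases (hx.1 i j).eq_or_lt with hz | hpos
  · rw [← hz, mul_zero]
    exact mul_nonneg (G.μ_pos i).le (G.v_nonneg i j)
  · have hv := h.price_le_value h0 hpos
    have hc := G.c_nonneg j
    calc (p j - G.c j) * x i j ≤ G.v i j * x i j := by gcongr; linarith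
      _ ≤ G.v i j * G.μ i := by gcongr; exacts [G.v_nonneg i j, hx.le_volume i j]
      _ = G.μ i * G.v i j := mul_comm _ _

/-- A buyer type pays at most the price of, and its valuation for, its most valued vendor. -/
lemma payment_le {G : PCGame N M} {x : N → M → ℝ} {p : M → ℝ} (hp : G.IsPrice p)
    (hx : G.IsAssignment x) (h : G.Consistent x p) {i : N} {j : M}
    (hv : ∀ k, G.v i k ≤ G.v i j) :
    ∑ k, p k * x i k ≤ min (p j) (G.v i j) * G.μ i := by
  rw [← hx.2 i, Finset.mul_sum]
  refine Finset.sum_le_sum fun k _ => ?_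
  rcases (hx.1 i k).eq_or_lt with hz | hpos
  · rw [← hz, mul_zero, mul_zero]
  · refine mul_le_mul_of_nonneg_right (le_min ?_ ?_) hpos.le
    · linarith [h i k hpos j, hv k]
    · exact (h.price_le_value hp.2 hpos).trans (hv k)

variable [DecidableEq M]

lemma util_le_theta {G : PCGame N M} {p : M → ℝ} (h0 : p G.abstain = 0) {j : M} {q : ℝ}
    (hq : G.c j ≤ q) (hj : j = G.abstain → q = 0) {y : N → M → ℝ} (hy : G.IsAssignment y)
    (hyc : G.Consistent y (Function.update p j q)) :
    G.util y (Function.update p j q) j ≤ G.theta p j := by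
  refine le_csSup ⟨∑ i, G.μ i * G.v i j, ?_⟩ ⟨q, y, hq, hj, hy, hyc, rfl⟩
  rintro _ ⟨q', y', -, hj', hy', hyc', rfl⟩
  refine util_le ?_ hy' hyc' j
  by_cases hja : G.abstain = j
  · rw [hja, Function.update_self, hj' hja.symm]
  · rwa [Function.update_of_ne hja]

/-- A vendor that at price `q` is a best choice of all buyer types in `S` can earn
the profit margin on their whole volume. -/
lemma margin_mul_volume_le_theta {G : PCGame N M} {p : M → ℝ} (h0 : p G.abstain = 0) {j : M}
    {q : ℝ} (hq : G.c j ≤ q) (hj : j = G.abstain → q = 0) (S : Finset N)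
    (hS : ∀ i ∈ S, ∀ k ≠ j, G.v i k - p k ≤ G.v i j - q) :
    (q - G.c j) * ∑ i ∈ S, G.μ i ≤ G.theta p j := by
  have hbest : ∀ i, ∃ k, (∀ k', G.v i k' - Function.update p j q k' ≤
      G.v i k - Function.update p j q k) ∧ (i ∈ S → k = j) := by
    intro i
    by_cases hi : i ∈ S
    · refine ⟨j, fun k' => ?_, fun _ => rfl⟩
      by_cases hk : k' = j
      · rw [hk]
      · rw [Function.update_of_ne hk, Function.update_self]
        exact hS i hi k' hk
    · obtain ⟨k, -, hk⟩ := Finset.exists_max_image Finset.univ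
        (fun k => G.v i k - Function.update p j q k) ⟨j, Finset.mem_univ j⟩
      exact ⟨k, fun k' => hk k' (Finset.mem_univ _), fun h => absurd h hi⟩
  choose f hf hfS using hbest
  let y : N → M → ℝ := fun i k => if k = f i then G.μ i else 0
  have hy : G.IsAssignment y := by
    refine ⟨fun i k => ?_, fun i => by simp [y]⟩
    dsimp only [y]
    split_ifs
    exacts [(G.μ_pos i).le, le_rfl]
  have hyc : G.Consistent y (Function.update p j q) := by
    intro i k hik k'
    by_cases hk : k = f i
    · rw [hk]
      exact hf i k'
    · simp [y, hk] at hik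
  refine le_trans ?_ (util_le_theta h0 hq hj hy hyc)
  rw [util, Function.update_self]
  refine mul_le_mul_of_nonneg_left ?_ (sub_nonneg.2 hq)
  calc ∑ i ∈ S, G.μ i = ∑ i ∈ S, y i j :=
        Finset.sum_congr rfl fun i hi => by simp [y, hfS i hi]
    _ ≤ ∑ i, y i j :=
        Finset.sum_le_sum_of_subset_of_nonneg (Finset.subset_univ S) fun i _ _ => hy.1 i j

lemma theta_abstain_nonneg {G : PCGame N M} {p : M → ℝ} (h0 : p G.abstain = 0) :
    0 ≤ G.theta p G.abstain := by
  simpa using margin_mul_volume_le_theta h0 G.c_abstain.le (fun _ => rfl) ∅ (by simp)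

/-- In the symmetric duopoly, vendor `j` can undercut its rival `k` profitably. -/
lemma duopoly_le_theta {ε : ℝ} (hε0 : 0 < ε) (hε1 : ε < 1) {G : PCGame N M} {p : M → ℝ}
    (hp : G.IsPrice p) {s o : N} (hso : s ≠ o) {j k : M} (hj : j ≠ G.abstain)
    (hM : ∀ l, l = G.abstain ∨ l = j ∨ l = k) (hμs : G.μ s = 1) (hμo : G.μ o = 1)
    (hcj : G.c j = 0) (hsj : G.v s j = 4 - ε) (hsk : G.v s k = 3)
    (hoj : G.v o j = 3) (hok : G.v o k = 4 - ε) :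
    min (p k) (4 - ε) + (1 - ε) ≤ G.theta p j := by
  classical
  have hpk : 0 ≤ p k := (G.c_nonneg k).trans (hp.1 k)
  rcases le_or_gt (p k) 3 with h | h
  · have key := margin_mul_volume_le_theta (G := G) (q := 1 - ε + p k) hp.2 (j := j)
      (by linarith) (fun h => absurd h hj) {s} (by
        simp only [Finset.mem_singleton, forall_eq]
        intro l hl
        rcases hM l with rfl | rfl | rfl
        · rw [G.v_abstain, hp.2, hsj]; linarith
        · exact absurd rfl hl
        · rw [hsk, hsj]; linarith)
    rw [Finset.sum_singleton, hμs, hcj] at key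
    linarith [min_le_left (p k) (4 - ε)]
  · have hq1 := min_le_left 3 (p k - 1 + ε)
    have hq2 := min_le_right 3 (p k - 1 + ε)
    have hq0 : 0 ≤ min 3 (p k - 1 + ε) := le_min (by norm_num) (by linarith)
    have key := margin_mul_volume_le_theta (G := G) (q := min 3 (p k - 1 + ε)) hp.2 (j := j)
      (by linarith) (fun h => absurd h hj) {s, o} (by
        simp only [Finset.mem_insert, Finset.mem_singleton]
        rintro i (rfl | rfl) l hl <;> rcases hM l with rfl | rfl | rfl
        · rw [G.v_abstain, hp.2, hsj]; linarith
        · exact absurd rfl hl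
        · rw [hsk, hsj]; linarith
        · rw [G.v_abstain, hp.2, hoj]; linarith
        · exact absurd rfl hl
        · rw [hok, hoj]; linarith)
    rw [Finset.sum_pair hso, hμs, hμo, hcj] at key
    rcases le_total 3 (p k - 1 + ε) with h3 | h3
    · rw [min_eq_left h3] at key
      linarith [min_le_right (p k) (4 - ε)]
    · rw [min_eq_right h3] at key
      linarith [min_le_left (p k) (4 - ε)]

/-- The duopoly in which each buyer type values its own vendor at `4 - ε` and the other
one at `3`. -/
noncomputable def duopoly (ε : ℝ) (hε : ε < 1) : PCGame Bool (Fin 3) where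
  abstain := 0
  μ _ := 1
  v i := if i then ![0, 4 - ε, 3] else ![0, 3, 4 - ε]
  c _ := 0
  μ_pos _ := one_pos
  v_nonneg i j := by
    have : 0 ≤ 4 - ε := by linarith
    cases i <;> fin_cases j <;> simp <;> linarith
  c_nonneg _ := le_rfl
  v_abstain i := by cases i <;> rfl
  c_abstain := rfl

lemma SWopt_of_duopoly {ε : ℝ} (hε1 : ε < 1) {G : PCGame Bool (Fin 3)}
    (hab : G.abstain = 0) (hμ : ∀ i, G.μ i = 1) (hc : ∀ j, G.c j = 0)
    (hvll : G.v true 1 = 4 - ε) (hvlr : G.v true 2 = 3)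
    (hvrl : G.v false 1 = 3) (hvrr : G.v false 2 = 4 - ε) :
    G.SWopt = 8 - 2 * ε := by
  have h0 : ∀ i, G.v i 0 = 0 := fun i => hab ▸ G.v_abstain i
  have hsup : ∀ i, Finset.univ.sup' ⟨G.abstain, Finset.mem_univ _⟩
      (fun j => G.v i j - G.c j) = 4 - ε := by
    intro i
    refine le_antisymm (Finset.sup'_le _ _ fun j _ => ?_) ?_
    · rw [hc]
      cases i <;> fin_cases j <;> simp [*] <;> linarith
    · cases i
      · exact Finset.le_sup'_of_le _ (Finset.mem_univ 2) (by rw [hvrr, hc, sub_zero])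
      · exact Finset.le_sup'_of_le _ (Finset.mem_univ 1) (by rw [hvll, hc, sub_zero])
  rw [SWopt, Fintype.sum_bool, hsup, hsup, hμ, hμ]
  ring

lemma le_sum_subsidy_of_duopoly {ε : ℝ} (hε0 : 0 < ε) (hε1 : ε < 1)
    {G : PCGame Bool (Fin 3)}
    (hab : G.abstain = 0) (hμ : ∀ i, G.μ i = 1) (hc : ∀ j, G.c j = 0)
    (hvll : G.v true 1 = 4 - ε) (hvlr : G.v true 2 = 3)
    (hvrl : G.v false 1 = 3) (hvrr : G.v false 2 = 4 - ε)
    {p : Fin 3 → ℝ} {x : Bool → Fin 3 → ℝ}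
    (hp : G.IsPrice p) (hx : G.IsAssignment x) (hxc : G.Consistent x p) :
    2 - 2 * ε ≤ ∑ j, G.subsidy x p j := by
  have h0 : ∀ i, G.v i 0 = 0 := fun i => hab ▸ G.v_abstain i
  have hθ0 := theta_abstain_nonneg hp.2
  have hθ1 := duopoly_le_theta hε0 hε1 hp (s := true) (o := false) (by decide)
    (j := 1) (k := 2) (by rw [hab]; decide) (by rw [hab]; decide) (hμ _) (hμ _) (hc _)
    hvll hvlr hvrl hvrr
  have hθ2 := duopoly_le_theta hε0 hε1 hp (s := false) (o := true) (by decide)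
    (j := 2) (k := 1) (by rw [hab]; decide) (by rw [hab]; decide) (hμ _) (hμ _) (hc _)
    hvrr hvrl hvlr hvll
  have ht := payment_le hp hx hxc (i := true) (j := 1) (by
    intro k; fin_cases k <;> simp [*] <;> linarith)
  have hf := payment_le hp hx hxc (i := false) (j := 2) (by
    intro k; fin_cases k <;> simp [*] <;> linarith)
  rw [hab] at hθ0
  rw [hμ, hvll, Fin.sum_univ_three] at ht
  rw [hμ, hvrr, Fin.sum_univ_three] at hf
  simp only [subsidy, util, hc, Fin.sum_univ_three, Fintype.sum_bool]
  linarith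

end PCGame

/-- in the game with valuations `4 - ε` / `3`, the optimal social
welfare is `8 - 2ε` and every pair of a price vector and consistent assignment
requires subsidies of total cost at least `2 - 2ε`; consequently, for every `δ > 0`
there is a game where every such pair requires subsidies of cost at least
`(1/4 - δ)·SW*`.  Buyer `true` is the left type, buyer `false` is the right type;
vendor `0` is the abstain option, `1` the left vendor, `2` the right vendor. -/
theorem stmt12 (ε : ℝ) (hε0 : 0 < ε) (hε1 : ε < 1)
    (G : PCGame Bool (Fin 3))
    (hab : G.abstain = 0)
    (hμ : ∀ i, G.μ i = 1)
    (hc : ∀ j, G.c j = 0)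
    (hvll : G.v true 1 = 4 - ε) (hvlr : G.v true 2 = 3)
    (hvrl : G.v false 1 = 3) (hvrr : G.v false 2 = 4 - ε) :
    G.SWopt = 8 - 2 * ε ∧
    (∀ (p : Fin 3 → ℝ) (x : Bool → Fin 3 → ℝ),
      G.IsPrice p → G.IsAssignment x → G.Consistent x p →
      2 - 2 * ε ≤ ∑ j, G.subsidy x p j) ∧
    (∀ δ : ℝ, 0 < δ → ∃ G' : PCGame Bool (Fin 3),
      ∀ (p : Fin 3 → ℝ) (x : Bool → Fin 3 → ℝ),
        G'.IsPrice p → G'.IsAssignment x → G'.Consistent x p →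
        (1 / 4 - δ) * G'.SWopt ≤ ∑ j, G'.subsidy x p j) := by
  refine ⟨PCGame.SWopt_of_duopoly hε1 hab hμ hc hvll hvlr hvrl hvrr, fun p x hp hx hxc =>
    PCGame.le_sum_subsidy_of_duopoly hε0 hε1 hab hμ hc hvll hvlr hvrl hvrr hp hx hxc, ?_⟩
  intro δ hδ
  have hη0 : 0 < min (1 / 2) δ := lt_min (by norm_num) hδ
  have hη1 : min (1 / 2) δ < 1 := (min_le_left _ _).trans_lt (by norm_num)
  have hηδ := min_le_right (1 / 2) δ
  generalize min (1 / 2) δ = η at hη0 hη1 hηδ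
  refine ⟨PCGame.duopoly η hη1, fun p x hp hx hxc => ?_⟩
  rw [PCGame.SWopt_of_duopoly (G := PCGame.duopoly η hη1) hη1 rfl (fun _ => rfl)
    (fun _ => rfl) rfl rfl rfl rfl]
  refine le_trans ?_ (PCGame.le_sum_subsidy_of_duopoly hη0 hη1 rfl (fun _ => rfl)
    (fun _ => rfl) rfl rfl rfl rfl hp hx hxc)
  nlinarith
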